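/- arXiv:2102.06973 — 2 statements merged into one kernel-verified Lean document; each statement's English description precedes it below -/
import Mathlib

section
/- Consider optimistic time-selection regret matching with q-regrets (the regret-matching-plus variant). Suppose that for each round t = 1,...,T: the link outputs are y^t_φ = Σ_{w ∈ W(φ)} w(t)·max(q^t_{φ,w} + m^t_{φ,w}, 0), where q^1 = 0 and q^{t+1}_{φ,w} = max(q^t_{φ,w} + w(t)·ρ^t(φ), 0), the m^t_{φ,w} ∈ ℝ are arbitrary prediction values, and z^t = Σ_{φ ∈ Φ} y^t_φ; and suppose the learner's mixed strategy π^t satisfies π^t(s') = (1/z^t)·Σ_{φ ∈ Φ} y^t_φ · Σ_{s : φ(s) = s'} π^t(s) for all s' ∈ S whenever z^t > 0 (π^t is arbitrary when z^t = 0). Then for every deviation φ ∈ Φ and every time selection function w ∈ W(φ), the cumulative time-selected regret satisfies Σ_{t=1}^T w(t)·ρ^t(φ) ≤ sqrt( Σ_{t=1}^T Σ_{φ' ∈ Φ} Σ_{w̄ ∈ W(φ')} ( w̄(t)·ρ^t(φ') − m^t_{φ',w̄} )² ). -/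
/-- One-step potential inequality for optimistic regret matching plus. -/
theorem sq_max_add_le_sq_add_sq_sub (q r m : ℝ) :
    max (q + r) 0 ^ 2 ≤ q ^ 2 + 2 * (r * max (q + m) 0) + (r - m) ^ 2 := by
  rcases le_total 0 (q + m) with h | h
  · rw [max_eq_left h]
    rcases le_total 0 (q + r) with h' | h'
    · rw [max_eq_left h']
      nlinarith [sq_nonneg m]
    · rw [max_eq_right h']
      nlinarith [sq_nonneg m, sq_nonneg (q + r)]
  · rw [max_eq_right h]
    rcases le_total 0 (q + r) with h' | h'
    · rw [max_eq_left h']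
      nlinarith [sq_nonneg q]
    · rw [max_eq_right h']
      nlinarith [sq_nonneg q, sq_nonneg (r - m)]

/-- A fixed point of the `y`-weighted mixture of deviations has zero `y`-weighted regret. -/
theorem sum_weight_mul_regret_eq_zero {S : Type*} [Fintype S] [DecidableEq S]
    (Φ : Finset (S → S)) (y : (S → S) → ℝ) (hy : ∀ φ ∈ Φ, 0 ≤ y φ) (p u : S → ℝ)
    (hfix : 0 < ∑ φ ∈ Φ, y φ → ∀ s' : S, p s' = (1 / ∑ φ ∈ Φ, y φ) *
      ∑ φ ∈ Φ, y φ * ∑ s ∈ Finset.univ.filter (fun s => φ s = s'), p s) :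
    ∑ φ ∈ Φ, y φ * ∑ s : S, p s * (u (φ s) - u s) = 0 := by
  rcases (Finset.sum_nonneg hy).eq_or_lt with h | h
  · have h0 := (Finset.sum_eq_zero_iff_of_nonneg hy).1 h.symm
    exact Finset.sum_eq_zero fun φ hφ => by rw [h0 φ hφ, zero_mul]
  · have hpush (φ : S → S) : ∑ s : S, p s * u (φ s) =
        ∑ s' : S, (∑ s ∈ Finset.univ.filter (fun s => φ s = s'), p s) * u s' := by
      rw [← Finset.sum_fiberwise Finset.univ φ]
      refine Finset.sum_congr rfl fun s' _ => ?_
      rw [Finset.sum_mul]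
      refine Finset.sum_congr rfl fun s hs => ?_
      rw [(Finset.mem_filter.1 hs).2]
    have hfix' (s' : S) : ∑ φ ∈ Φ, y φ * ∑ s ∈ Finset.univ.filter (fun s => φ s = s'), p s =
        (∑ φ ∈ Φ, y φ) * p s' := by
      rw [hfix h s', ← mul_assoc, mul_one_div_cancel h.ne', one_mul]
    simp only [mul_sub, Finset.sum_sub_distrib]
    rw [sub_eq_zero, ← Finset.sum_mul, Finset.mul_sum]
    simp only [hpush, Finset.mul_sum (Finset.univ : Finset S)]
    rw [Finset.sum_comm]
    refine Finset.sum_congr rfl fun s' _ => ?_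
    rw [← mul_assoc, ← hfix' s', Finset.sum_mul]
    exact Finset.sum_congr rfl fun φ _ => (mul_assoc _ _ _).symm


/-- Optimistic time-selection regret matching with q-regrets (regret-matching-plus):
for every deviation `φ ∈ Φ` and time selection function `w ∈ W φ`, the cumulative
time-selected regret is bounded by the square root of the sum of squared prediction
errors. Rounds are indexed `0, ..., T-1`. -/
theorem optimistic_time_selection_regret_matching_plus_bound
    {S : Type*} [Fintype S] [Nonempty S] [DecidableEq S]
    (T : ℕ)
    (Φ : Finset (S → S))
    (W : (S → S) → Finset (ℕ → ℝ))
    (hW : ∀ φ ∈ Φ, ∀ w ∈ W φ, ∀ t < T, 0 ≤ w t ∧ w t ≤ 1)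
    (π : ℕ → S → ℝ)
    (hπ0 : ∀ t < T, ∀ s : S, 0 ≤ π t s)
    (hπ1 : ∀ t < T, ∑ s : S, π t s = 1)
    (u : ℕ → S → ℝ)
    (ρ : ℕ → (S → S) → ℝ)
    (hρ : ∀ t < T, ∀ φ : S → S, ρ t φ = ∑ s : S, π t s * (u t (φ s) - u t s))
    (m : ℕ → (S → S) → (ℕ → ℝ) → ℝ)
    (q : ℕ → (S → S) → (ℕ → ℝ) → ℝ)
    (hq0 : ∀ φ w, q 0 φ w = 0)
    (hqsucc : ∀ t < T, ∀ φ w, q (t + 1) φ w = max (q t φ w + w t * ρ t φ) 0)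
    (y : ℕ → (S → S) → ℝ)
    (hy : ∀ t < T, ∀ φ : S → S, y t φ = ∑ w ∈ W φ, w t * max (q t φ w + m t φ w) 0)
    (z : ℕ → ℝ)
    (hz : ∀ t < T, z t = ∑ φ ∈ Φ, y t φ)
    (hfix : ∀ t < T, 0 < z t → ∀ s' : S,
      π t s' = (1 / z t) *
        ∑ φ ∈ Φ, y t φ * ∑ s ∈ Finset.univ.filter (fun s => φ s = s'), π t s) :
    ∀ φ ∈ Φ, ∀ w ∈ W φ,
      ∑ t ∈ Finset.range T, w t * ρ t φ ≤
        Real.sqrt (∑ t ∈ Finset.range T, ∑ φ' ∈ Φ, ∑ w' ∈ W φ',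
          (w' t * ρ t φ' - m t φ' w') ^ 2) := by
  have hstep : ∀ t < T, ∑ φ ∈ Φ, ∑ w ∈ W φ, q (t + 1) φ w ^ 2 ≤
      ∑ φ ∈ Φ, ∑ w ∈ W φ, q t φ w ^ 2 +
        ∑ φ ∈ Φ, ∑ w ∈ W φ, (w t * ρ t φ - m t φ w) ^ 2 := by
    intro t ht
    have hy_nonneg : ∀ φ ∈ Φ, 0 ≤ y t φ := fun φ hφ => by
      rw [hy t ht]
      exact Finset.sum_nonneg fun w hw =>
        mul_nonneg (hW φ hφ w hw t ht).1 (le_max_right _ _)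
    have hzero : ∑ φ ∈ Φ, ∑ w ∈ W φ, w t * ρ t φ * max (q t φ w + m t φ w) 0 = 0 := by
      refine Eq.trans ?_ (sum_weight_mul_regret_eq_zero Φ (y t) hy_nonneg (π t) (u t)
        (by rw [← hz t ht]; exact hfix t ht))
      refine Finset.sum_congr rfl fun φ _ => ?_
      rw [← hρ t ht, hy t ht, Finset.sum_mul]
      exact Finset.sum_congr rfl fun w _ => mul_right_comm _ _ _
    calc ∑ φ ∈ Φ, ∑ w ∈ W φ, q (t + 1) φ w ^ 2
        ≤ ∑ φ ∈ Φ, ∑ w ∈ W φ, (q t φ w ^ 2 +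
            2 * (w t * ρ t φ * max (q t φ w + m t φ w) 0) +
            (w t * ρ t φ - m t φ w) ^ 2) := by
          refine Finset.sum_le_sum fun φ _ => Finset.sum_le_sum fun w _ => ?_
          rw [hqsucc t ht]
          exact sq_max_add_le_sq_add_sq_sub _ _ _
      _ = _ := by
          simp only [Finset.sum_add_distrib, ← Finset.mul_sum]
          rw [hzero, mul_zero, add_zero]
  have hpotential : ∀ n ≤ T, ∑ φ ∈ Φ, ∑ w ∈ W φ, q n φ w ^ 2 ≤
      ∑ t ∈ Finset.range n, ∑ φ ∈ Φ, ∑ w ∈ W φ, (w t * ρ t φ - m t φ w) ^ 2 := by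
    intro n
    induction n with
    | zero => simp [hq0]
    | succ n ih =>
      intro hn
      rw [Finset.sum_range_succ]
      linarith [hstep n hn, ih (Nat.le_of_succ_le hn)]
  intro φ hφ w hw
  have hregret : ∀ n ≤ T, ∑ t ∈ Finset.range n, w t * ρ t φ ≤ q n φ w := by
    intro n
    induction n with
    | zero => simp [hq0]
    | succ n ih =>
      intro hn
      rw [Finset.sum_range_succ, hqsucc n hn]
      exact (add_le_add_left (ih (Nat.le_of_succ_le hn)) _).trans (le_max_left _ _)
  refine (hregret T le_rfl).trans (Real.le_sqrt_of_sq_le ?_)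
  calc q T φ w ^ 2 ≤ ∑ w' ∈ W φ, q T φ w' ^ 2 :=
        Finset.single_le_sum (f := fun w' => q T φ w' ^ 2) (fun _ _ => sq_nonneg _) hw
    _ ≤ ∑ φ' ∈ Φ, ∑ w' ∈ W φ', q T φ' w' ^ 2 :=
        Finset.single_le_sum (f := fun φ' => ∑ w' ∈ W φ', q T φ' w' ^ 2)
          (fun _ _ => Finset.sum_nonneg fun _ _ => sq_nonneg _) hφ
    _ ≤ _ := hpotential T le_rfl
end

section
/- Consider approximate time-selection regret matching: suppose that for each round t = 1,...,T the link outputs are y^t_φ = Σ_{w ∈ W(φ)} w(t)·max(ỹ^t_{φ,w}, 0), where the ỹ^t_{φ,w} ∈ ℝ are arbitrary approximation values, z^t = Σ_{φ ∈ Φ} y^t_φ, and the learner's mixed strategy π^t satisfies π^t(s') = (1/z^t)·Σ_{φ ∈ Φ} y^t_φ · Σ_{s : φ(s) = s'} π^t(s) for all s' ∈ S whenever z^t > 0 (π^t is arbitrary when z^t = 0). Let x^t_{φ,w} = Σ_{τ=1}^{t−1} w(τ)·ρ^τ(φ) denote the exact cumulative time-selected regret before round t. Then for every deviation φ ∈ Φ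 and every time selection function w ∈ W(φ), Σ_{t=1}^T w(t)·ρ^t(φ) ≤ sqrt( Σ_{t=1}^T Σ_{φ' ∈ Φ} Σ_{w̄ ∈ W(φ')} ( x^t_{φ',w̄} + w̄(t)·ρ^t(φ') − ỹ^t_{φ',w̄} )² ). -/
/-- One-step potential bound for approximate regret matching in a single coordinate. -/
theorem sq_posPart_add_le (a r b : ℝ) :
    max (a + r) 0 ^ 2 ≤ max a 0 ^ 2 + 2 * (max b 0 * r) + (a + r - b) ^ 2 := by
  rcases le_total a 0 with ha | ha <;> rcases le_total b 0 with hb | hb <;>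
    rcases le_total (a + r) 0 with hc | hc <;>
    simp only [max_eq_left, max_eq_right, ha, hb, hc] <;>
    nlinarith [sq_nonneg (a - b), sq_nonneg (a + r),
      sq_nonneg (a + r - b), mul_nonneg (sub_nonneg.2 ha) (sub_nonneg.2 hb),
      mul_nonneg (sub_nonneg.2 hc) (sub_nonneg.2 hb)]

/-- If `p` is a fixed point of the `y`-weighted average of the deviations in `Φ`, then the
`y`-weighted instantaneous regrets of `p` sum to zero. -/
theorem sum_mul_regret_eq_zero {S : Type*} [Fintype S] [DecidableEq S]
    (Φ : Finset (S → S)) (y : (S → S) → ℝ) (p u : S → ℝ)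
    (hfix : ∀ s', (∑ φ ∈ Φ, y φ) * p s' =
      ∑ φ ∈ Φ, y φ * ∑ s ∈ Finset.univ.filter (fun s => φ s = s'), p s) :
    ∑ φ ∈ Φ, y φ * ∑ s, p s * (u (φ s) - u s) = 0 := by
  have hpush (φ : S → S) : ∑ s, p s * u (φ s) =
      ∑ s', (∑ s ∈ Finset.univ.filter (fun s => φ s = s'), p s) * u s' := by
    rw [← Finset.sum_fiberwise Finset.univ φ]
    refine Finset.sum_congr rfl fun s' _ => ?_
    rw [Finset.sum_mul]
    refine Finset.sum_congr rfl fun s hs => ?_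
    rw [(Finset.mem_filter.1 hs).2]
  simp only [mul_sub, Finset.sum_sub_distrib]
  rw [sub_eq_zero, ← Finset.sum_mul, Finset.mul_sum]
  simp only [← mul_assoc, hfix, hpush, Finset.mul_sum]
  rw [Finset.sum_comm]
  simp only [Finset.sum_mul, mul_assoc]

/-- Approximate time-selection regret matching: for every deviation `φ ∈ Φ` and time
selection function `w ∈ W φ`, the cumulative time-selected regret is bounded by the
square root of the sum of squared approximation errors, where
`x^t_{φ,w} = ∑_{τ<t} w(τ) ρ^τ(φ)` is the exact cumulative time-selected regret before
round `t`. Rounds are indexed `0, ..., T-1`. -/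
theorem approximate_time_selection_regret_matching_bound
    {S : Type*} [Fintype S] [Nonempty S] [DecidableEq S]
    (T : ℕ)
    (Φ : Finset (S → S))
    (W : (S → S) → Finset (ℕ → ℝ))
    (hW : ∀ φ ∈ Φ, ∀ w ∈ W φ, ∀ t < T, 0 ≤ w t ∧ w t ≤ 1)
    (π : ℕ → S → ℝ)
    (hπ0 : ∀ t < T, ∀ s : S, 0 ≤ π t s)
    (hπ1 : ∀ t < T, ∑ s : S, π t s = 1)
    (u : ℕ → S → ℝ)
    (ρ : ℕ → (S → S) → ℝ)
    (hρ : ∀ t < T, ∀ φ : S → S, ρ t φ = ∑ s : S, π t s * (u t (φ s) - u t s))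
    (ytilde : ℕ → (S → S) → (ℕ → ℝ) → ℝ)
    (y : ℕ → (S → S) → ℝ)
    (hy : ∀ t < T, ∀ φ : S → S, y t φ = ∑ w ∈ W φ, w t * max (ytilde t φ w) 0)
    (z : ℕ → ℝ)
    (hz : ∀ t < T, z t = ∑ φ ∈ Φ, y t φ)
    (hfix : ∀ t < T, 0 < z t → ∀ s' : S,
      π t s' = (1 / z t) *
        ∑ φ ∈ Φ, y t φ * ∑ s ∈ Finset.univ.filter (fun s => φ s = s'), π t s)
    (x : ℕ → (S → S) → (ℕ → ℝ) → ℝ)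
    (hx : ∀ t φ w, x t φ w = ∑ τ ∈ Finset.range t, w τ * ρ τ φ) :
    ∀ φ ∈ Φ, ∀ w ∈ W φ,
      ∑ t ∈ Finset.range T, w t * ρ t φ ≤
        Real.sqrt (∑ t ∈ Finset.range T, ∑ φ' ∈ Φ, ∑ w' ∈ W φ',
          (x t φ' w' + w' t * ρ t φ' - ytilde t φ' w') ^ 2) := by
  have hy0 : ∀ t < T, ∀ φ ∈ Φ, 0 ≤ y t φ := fun t ht φ hφ => by
    rw [hy t ht φ]
    exact Finset.sum_nonneg fun w hw => mul_nonneg (hW φ hφ w hw t ht).1 (le_max_right _ _)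
  have hblackwell : ∀ t < T, ∑ φ ∈ Φ, y t φ * ρ t φ = 0 := by
    intro t ht
    rcases (Finset.sum_nonneg (hy0 t ht)).eq_or_lt with h | h
    · have hzero := (Finset.sum_eq_zero_iff_of_nonneg (hy0 t ht)).1 h.symm
      exact Finset.sum_eq_zero fun φ hφ => by rw [hzero φ hφ, zero_mul]
    · simp only [hρ t ht]
      refine sum_mul_regret_eq_zero Φ (y t) (π t) (u t) fun s' => ?_
      have hz' := hfix t ht (by rwa [hz t ht]) s'
      rw [hz t ht, one_div] at hz'
      exact (eq_inv_mul_iff_mul_eq₀ h.ne').1 hz'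
  have hsucc : ∀ t φ w, x (t + 1) φ w = x t φ w + w t * ρ t φ := fun t φ w => by
    rw [hx, hx, Finset.sum_range_succ]
  have hpotential : ∀ n ≤ T, ∑ φ ∈ Φ, ∑ w ∈ W φ, max (x n φ w) 0 ^ 2 ≤
      ∑ t ∈ Finset.range n, ∑ φ ∈ Φ, ∑ w ∈ W φ,
        (x t φ w + w t * ρ t φ - ytilde t φ w) ^ 2 := by
    intro n
    induction n with
    | zero => simp [hx]
    | succ n ih =>
      intro hn
      have hcross : ∑ φ ∈ Φ, ∑ w ∈ W φ, 2 * (max (ytilde n φ w) 0 * (w n * ρ n φ)) = 0 := by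
        refine Eq.trans ?_ ((congrArg (2 * ·) (hblackwell n hn)).trans (mul_zero 2))
        simp only [Finset.mul_sum]
        refine Finset.sum_congr rfl fun φ _ => ?_
        rw [hy n hn, Finset.sum_mul, Finset.mul_sum]
        exact Finset.sum_congr rfl fun w _ => by ring
      have hstep : ∑ φ ∈ Φ, ∑ w ∈ W φ, max (x (n + 1) φ w) 0 ^ 2 ≤
          ∑ φ ∈ Φ, ∑ w ∈ W φ, (max (x n φ w) 0 ^ 2 +
            2 * (max (ytilde n φ w) 0 * (w n * ρ n φ)) +
            (x n φ w + w n * ρ n φ - ytilde n φ w) ^ 2) :=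
        Finset.sum_le_sum fun φ _ => Finset.sum_le_sum fun w _ => by
          rw [hsucc]
          exact sq_posPart_add_le _ _ _
      simp only [Finset.sum_add_distrib] at hstep
      rw [Finset.sum_range_succ]
      linarith [ih (by omega)]
  intro φ hφ w hw
  rw [← hx]
  refine (le_max_left _ 0).trans (Real.le_sqrt_of_sq_le (le_trans ?_ (hpotential T le_rfl)))
  calc max (x T φ w) 0 ^ 2 ≤ ∑ w' ∈ W φ, max (x T φ w') 0 ^ 2 :=
        Finset.single_le_sum (f := fun w' => max (x T φ w') 0 ^ 2)
          (fun _ _ => sq_nonneg _) hw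
    _ ≤ _ := Finset.single_le_sum (f := fun φ' => ∑ w' ∈ W φ', max (x T φ' w') 0 ^ 2)
          (fun _ _ => Finset.sum_nonneg fun _ _ => sq_nonneg _) hφ
end
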